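/- arXiv:1609.01677 — 2 statements merged into one kernel-verified Lean document; each statement's English description precedes it below -/
import Mathlib

section
/- Let G be a finite simple graph on n ≥ 2 vertices. Then (Σ_{{x,y}} 1/√(δ(x,y)+1))² ≤ C(n,2)·n·hom(G), where the sum ranges over all unordered pairs {x,y} of distinct vertices of G and C(n,2) = n(n-1)/2. -/
open Finset
open scoped Classical

/-- The number of distinct vertex degrees in the subgraph of `G` induced by `s`. -/
noncomputable def distinctDegrees {V : Type*} (G : SimpleGraph V) (s : Finset V) : ℕ :=
  (s.image fun x => (s.filter fun y => G.Adj x y).card).card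

/-- `f(G)`: the largest number of distinct degrees in an induced subgraph of `G`. -/
noncomputable def fNumber {V : Type*} [Fintype V] (G : SimpleGraph V) : ℕ :=
  sSup {m : ℕ | ∃ s : Finset V, distinctDegrees G s = m}

/-- `hom(G)`: the size of the largest clique or independent set of `G`. -/
noncomputable def homNumber {V : Type*} (G : SimpleGraph V) : ℕ :=
  sSup {n : ℕ | ∃ s : Finset V, (G.IsClique ↑s ∨ Gᶜ.IsClique ↑s) ∧ s.card = n}

/-- The neighbourhood-distance `δ(x,y) = |(Γ(x)\{y}) △ (Γ(y)\{x})|`. -/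
noncomputable def nbhdDist {V : Type*} [Fintype V] (G : SimpleGraph V) (x y : V) : ℕ :=
  (symmDiff ((G.neighborFinset x).erase y) ((G.neighborFinset y).erase x)).card

/-- Every clique or independent set has size at most `homNumber G`. -/
theorem card_le_homNumber {V : Type*} [Fintype V] (G : SimpleGraph V) (s : Finset V)
    (hs : G.IsClique ↑s ∨ Gᶜ.IsClique ↑s) : s.card ≤ homNumber G := by
  refine le_csSup ⟨Fintype.card V, ?_⟩ ⟨s, hs, rfl⟩
  rintro _ ⟨t, -, rfl⟩
  exact t.card_le_univ

theorem mem_symmDiff_neighborFinset {V : Type*} [Fintype V] (G : SimpleGraph V) {x y z : V}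
    (hx : z ≠ x) (hy : z ≠ y) :
    z ∈ symmDiff ((G.neighborFinset x).erase y) ((G.neighborFinset y).erase x) ↔
      ¬(G.Adj x z ↔ G.Adj y z) := by
  simp only [Finset.mem_symmDiff, Finset.mem_erase, SimpleGraph.mem_neighborFinset]
  tauto

/-- A uniformly random ordering attains its maximum over `T` at a given element of `T` with
probability at least `1 / |T|`. -/
theorem card_equiv_fin_le_card_mul_card_filter {V : Type*} [Fintype V] {n : ℕ}
    (T : Finset V) {y : V} (hy : y ∈ T) :
    Fintype.card (V ≃ Fin n) ≤
      T.card * (univ.filter fun σ : V ≃ Fin n => ∀ z ∈ T, σ z ≤ σ y).card := by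
  have hcover : (univ : Finset (V ≃ Fin n)) ⊆
      T.biUnion fun t => univ.filter fun σ : V ≃ Fin n => ∀ z ∈ T, σ z ≤ σ t := by
    intro σ _
    obtain ⟨t, ht, hmax⟩ := T.exists_max_image σ ⟨y, hy⟩
    simp only [Finset.mem_biUnion, Finset.mem_filter, Finset.mem_univ, true_and]
    exact ⟨t, ht, hmax⟩
  rw [← Finset.card_univ]
  refine (Finset.card_le_card hcover).trans (Finset.card_biUnion_le_card_mul _ _ _ fun t ht => ?_)
  refine Finset.card_le_card_of_injOn (fun σ => (Equiv.swap y t).trans σ) ?_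
    (fun σ _ τ _ h => by
      simpa [← Equiv.trans_assoc] using congrArg (Equiv.trans (Equiv.swap y t)) h)
  intro σ hσ
  simp only [Finset.coe_filter, Finset.mem_univ, true_and, Set.mem_ofPred_eq] at hσ ⊢
  intro z hz
  simp only [Equiv.trans_apply, Equiv.swap_apply_left]
  refine hσ _ ?_
  rw [Equiv.swap_apply_def]
  split_ifs <;> assumption

/-- For a linear order on the vertices and a vertex `x`, the vertices `y` that come after every
vertex distinguishing `x` from `y` split into a clique and an independent set. -/
theorem card_filter_symmDiff_lt_le {V α : Type*} [Fintype V] [LinearOrder α]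
    (G : SimpleGraph V) (x : V) (σ : V → α) (hσ : Function.Injective σ) :
    (univ.filter fun y => y ≠ x ∧
      ∀ z ∈ symmDiff ((G.neighborFinset x).erase y) ((G.neighborFinset y).erase x),
        σ z ≤ σ y).card ≤ 2 * homNumber G := by
  set S := univ.filter fun y => y ≠ x ∧
      ∀ z ∈ symmDiff ((G.neighborFinset x).erase y) ((G.neighborFinset y).erase x), σ z ≤ σ y
    with hS
  have key : ∀ y ∈ S, ∀ z ∈ S, σ y < σ z → (G.Adj x z ↔ G.Adj y z) := by
    intro y hy z hz hlt
    simp only [hS, Finset.mem_filter, Finset.mem_univ, true_and] at hy hz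
    by_contra h
    have hzy : z ≠ y := by rintro rfl; exact lt_irrefl _ hlt
    exact (hy.2 z ((mem_symmDiff_neighborFinset G hz.1 hzy).2 h)).not_gt hlt
  have hclique : G.IsClique ↑(S.filter fun y => G.Adj x y) := by
    intro y hy z hz hyz
    simp only [Finset.coe_filter, Set.mem_ofPred_eq] at hy hz
    rcases lt_or_gt_of_ne (hσ.ne hyz) with h | h
    · exact (key y hy.1 z hz.1 h).1 hz.2
    · exact ((key z hz.1 y hy.1 h).1 hy.2).symm
  have hindep : Gᶜ.IsClique ↑(S.filter fun y => ¬G.Adj x y) := by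
    intro y hy z hz hyz
    simp only [Finset.coe_filter, Set.mem_ofPred_eq] at hy hz
    refine (SimpleGraph.compl_adj _ _ _).2 ⟨hyz, fun hadj => ?_⟩
    rcases lt_or_gt_of_ne (hσ.ne hyz) with h | h
    · exact hz.2 ((key y hy.1 z hz.1 h).2 hadj)
    · exact hy.2 ((key z hz.1 y hy.1 h).2 hadj.symm)
  have h₁ := card_le_homNumber G _ (Or.inl hclique)
  have h₂ := card_le_homNumber G _ (Or.inr hindep)
  have h₃ := Finset.card_filter_add_card_filter_not (s := S) fun y => G.Adj x y
  omega

theorem sum_one_div_nbhdDist_add_one_le {V : Type*} [Fintype V]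
    (G : SimpleGraph V) (x : V) :
    ∑ y ∈ univ.filter (· ≠ x), (1 : ℝ) / ((nbhdDist G x y : ℝ) + 1) ≤ 2 * homNumber G := by
  set D : V → Finset V := fun y =>
    symmDiff ((G.neighborFinset x).erase y) ((G.neighborFinset y).erase x) with hD
  have hpos : (0 : ℝ) < Fintype.card (V ≃ Fin (Fintype.card V)) := by
    have : Nonempty (V ≃ Fin (Fintype.card V)) := ⟨Fintype.equivFin V⟩
    exact_mod_cast Fintype.card_pos
  have hterm : ∀ y,
      (Fintype.card (V ≃ Fin (Fintype.card V)) : ℝ) * (1 / ((nbhdDist G x y : ℝ) + 1)) ≤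
      (univ.filter fun σ : V ≃ Fin (Fintype.card V) => ∀ z ∈ D y, σ z ≤ σ y).card := by
    intro y
    have h := card_equiv_fin_le_card_mul_card_filter (n := Fintype.card V) (insert y (D y))
      (Finset.mem_insert_self _ _)
    have hcard : (insert y (D y)).card ≤ nbhdDist G x y + 1 := Finset.card_insert_le _ _
    simp only [Finset.forall_mem_insert, le_refl, true_and] at h
    rw [mul_one_div, div_le_iff₀ (by positivity), mul_comm]
    exact_mod_cast h.trans (Nat.mul_le_mul_right _ hcard)
  have hcount : ∑ y ∈ univ.filter (· ≠ x),
      (univ.filter fun σ : V ≃ Fin (Fintype.card V) => ∀ z ∈ D y, σ z ≤ σ y).card ≤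
        Fintype.card (V ≃ Fin (Fintype.card V)) * (2 * homNumber G) := by
    have hswap := Finset.sum_card_bipartiteAbove_eq_sum_card_bipartiteBelow
      (s := univ.filter (· ≠ x)) (t := (univ : Finset (V ≃ Fin (Fintype.card V))))
      (fun y σ => ∀ z ∈ D y, σ z ≤ σ y)
    simp only [Finset.bipartiteAbove, Finset.bipartiteBelow, Finset.filter_filter] at hswap
    rw [hswap, ← Finset.card_univ, ← smul_eq_mul]
    exact Finset.sum_le_card_nsmul _ _ _ fun σ _ =>
      card_filter_symmDiff_lt_le G x σ σ.injective
  refine le_of_mul_le_mul_left ?_ hpos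
  rw [Finset.mul_sum]
  refine (Finset.sum_le_sum fun y _ => hterm y).trans ?_
  exact_mod_cast hcount

/-- For `n ≥ 2`, `(Σ_{{x,y}} 1/√(δ(x,y)+1))² ≤ C(n,2)·n·hom(G)`, the sum ranging over all
unordered pairs of distinct vertices.  (Since `δ` is symmetric, the sum over unordered pairs
equals half the sum over ordered pairs.) -/
theorem stmt_10 (n : ℕ) (hn : 2 ≤ n) (G : SimpleGraph (Fin n)) :
    ((∑ p ∈ Finset.univ.offDiag,
        (1 : ℝ) / Real.sqrt ((nbhdDist G p.1 p.2 : ℝ) + 1)) / 2) ^ 2 ≤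
      (n.choose 2 : ℝ) * (n : ℝ) * (homNumber G : ℝ) := by
  have hsum : ∑ p ∈ (univ : Finset (Fin n)).offDiag, (1 : ℝ) / ((nbhdDist G p.1 p.2 : ℝ) + 1) ≤
      n * (2 * homNumber G) := by
    have hsplit : ∑ p ∈ (univ : Finset (Fin n)).offDiag,
        (1 : ℝ) / ((nbhdDist G p.1 p.2 : ℝ) + 1) =
        ∑ x, ∑ y ∈ univ.filter (· ≠ x), (1 : ℝ) / ((nbhdDist G x y : ℝ) + 1) :=
      Finset.sum_finset_product _ _ _ fun p => by simp [Finset.mem_offDiag, eq_comm]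
    rw [hsplit]
    simpa using Finset.sum_le_card_nsmul univ _ _ fun x _ =>
      sum_one_div_nbhdDist_add_one_le G x
  have hcs := sq_sum_le_card_mul_sum_sq (s := (univ : Finset (Fin n)).offDiag)
    (f := fun p => (1 : ℝ) / Real.sqrt ((nbhdDist G p.1 p.2 : ℝ) + 1))
  have hsq : ∀ p : Fin n × Fin n, ((1 : ℝ) / Real.sqrt ((nbhdDist G p.1 p.2 : ℝ) + 1)) ^ 2 =
      1 / ((nbhdDist G p.1 p.2 : ℝ) + 1) := fun p => by
    rw [div_pow, Real.sq_sqrt (by positivity), one_pow]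
  have hcard : ((univ : Finset (Fin n)).offDiag.card : ℝ) = 2 * (n.choose 2 : ℝ) := by
    rw [Finset.offDiag_card, Finset.card_univ, Fintype.card_fin, Nat.cast_choose_two,
      Nat.cast_sub (Nat.le_mul_self n)]
    push_cast
    ring
  simp only [hsq, hcard] at hcs
  rw [div_pow]
  have h := mul_le_mul_of_nonneg_left hsum (by positivity : (0 : ℝ) ≤ 2 * (n.choose 2 : ℝ))
  linarith
end

section
/- Fix an integer k ≥ 2 and a real 0 < ε < 1/2, and set β = ε/(10k), η = εβ/(10⁵k²), J = 10⁴·k¹²·2^{4k}/η⁴ and K = 2·(10⁶k² + J·log(10⁴k)/log(1+β/2)). There exists N = N(k,ε) such that for every n ≥ N the following holds: if G is a finite simple graph on n vertices with hom(G) < n/(k-1+ε) and f(G) < k, then there exist pairwise disjoint sets A₁, A₂, …, A_m of vertices of G such that (1) |A₁ ∪ A₂ ∪ ⋯ ∪ A_m| > (1-β)n, (2) |A_i| > βn/(10⁴k) for each 1 ≤ i ≤ m, (3) δ(x,y) < K whenever x and y lie in the same set A_i, and (4) δ(x,y) > J whenever x ∈ A_i and y ∈ A_j with i ≠ j. -/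
open Finset
open scoped Classical

/-- If every two of the predicates `P i` differ on many points of `W`, then some subset of `W`
separates the counts of all of them, whatever constants are added to the counts. -/
theorem exists_subset_injective_count {V : Type*} {k : ℕ} (W : Finset V) (P : Fin k → V → Prop)
    (c : Fin k → ℕ)
    (h : ∀ i j, i ≠ j → k ^ 2 * 2 ^ k < (W.filter fun z => ¬ (P i z ↔ P j z)).card) :
    ∃ S ⊆ W, Function.Injective fun i => c i + (S.filter fun z => P i z).card := by
  obtain ⟨S, hS, hmin⟩ := Finset.exists_min_image W.powerset
    (fun S => (univ.filter fun q : Fin k × Fin k => q.1 ≠ q.2 ∧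
      c q.1 + (S.filter fun z => P q.1 z).card = c q.2 + (S.filter fun z => P q.2 z).card).card)
    ⟨∅, by simp⟩
  rw [mem_powerset] at hS
  refine ⟨S, hS, fun i j hij => ?_⟩
  by_contra hne
  obtain ⟨T, -, hT⟩ := Finset.exists_lt_card_fiber_of_mul_lt_card_of_maps_to
    (s := W.filter fun z => ¬ (P i z ↔ P j z)) (t := (univ : Finset (Finset (Fin k))))
    (f := fun z => univ.filter fun l => P l z) (n := k ^ 2) (fun _ _ => mem_univ _)
    (by simpa [mul_comm] using h i j hne)
  set F := (W.filter fun z => ¬ (P i z ↔ P j z)).filter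
    fun z => (univ.filter fun l => P l z) = T with hF
  have hFP : ∀ z ∈ F, ∀ l, P l z ↔ l ∈ T := by
    intro z hz l
    rw [← (mem_filter.1 hz).2]
    simp
  have hFW : F ⊆ W := (filter_subset _ _).trans (filter_subset _ _)
  have hTij : ¬ (i ∈ T ↔ j ∈ T) := by
    obtain ⟨z, hz⟩ := Finset.card_pos.1 (lt_of_le_of_lt (Nat.zero_le _) hT)
    rw [← hFP z hz, ← hFP z hz]
    exact (mem_filter.1 (mem_filter.1 hz).1).2
  set e : Fin k → ℕ := fun l => c l + ((S \ F).filter fun z => P l z).card with he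
  have hcount : ∀ R ⊆ F, ∀ l, c l + ((S \ F ∪ R).filter fun z => P l z).card =
      e l + if l ∈ T then R.card else 0 := by
    intro R hR l
    have hR' : (R.filter fun z => P l z) = if l ∈ T then R else ∅ := by
      ext z
      by_cases hl : l ∈ T
      · simp only [mem_filter, hl, if_true]
        exact ⟨fun h => h.1, fun h => ⟨h, (hFP z (hR h) l).2 hl⟩⟩
      · simp only [mem_filter, hl, if_false, notMem_empty, iff_false]
        exact fun h => hl ((hFP z (hR h.1) l).1 h.2)
    rw [filter_union, card_union_of_disjoint, hR', he]
    · split_ifs <;> simp [add_assoc]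
    · exact disjoint_filter_filter (disjoint_of_subset_right hR sdiff_disjoint)
  have hSF : S \ F ∪ S ∩ F = S := sdiff_union_inter S F
  have hSc := hcount (S ∩ F) inter_subset_right
  rw [hSF] at hSc
  obtain ⟨t, ht, htb⟩ : ∃ t ∈ range (k ^ 2 + 1),
      t ∉ univ.image fun q : Fin k × Fin k => e q.2 - e q.1 := by
    apply Finset.exists_mem_notMem_of_card_lt_card
    refine lt_of_le_of_lt Finset.card_image_le ?_
    simp [sq]
  have htb' : ∀ a b, a ∈ T → b ∉ T → e a + t ≠ e b := fun a b _ _ hab =>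
    htb (mem_image.2 ⟨(a, b), mem_univ _, by dsimp only; omega⟩)
  obtain ⟨R, hRF, hRt⟩ := Finset.exists_subset_card_eq (s := F) (n := t)
    (by have := mem_range.1 ht; omega)
  have hRc := hcount R hRF
  rw [hRt] at hRc
  refine absurd (hmin (S \ F ∪ R) (mem_powerset.2
    (union_subset (sdiff_subset.trans hS) (hRF.trans hFW)))) (not_le.2 (card_lt_card ?_))
  refine (ssubset_iff_of_subset ?_).2 ⟨(i, j), ?_, ?_⟩
  · rintro ⟨a, b⟩ hab
    simp only [mem_filter, mem_univ, true_and] at hab ⊢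
    refine ⟨hab.1, ?_⟩
    have h2 := hab.2
    rw [hRc, hRc] at h2
    rw [hSc, hSc]
    by_cases ha : a ∈ T <;> by_cases hb : b ∈ T <;> simp only [ha, hb, if_true, if_false] at h2 ⊢
    · omega
    · exact absurd h2 (htb' a b ha hb)
    · exact absurd h2.symm (htb' b a hb ha)
    · omega
  · simp only [mem_filter, mem_univ, true_and]
    exact ⟨hne, hij⟩
  · simp only [mem_filter, mem_univ, true_and, not_and]
    intro _ h2
    rw [hRc, hRc] at h2
    by_cases ha : i ∈ T <;> by_cases hb : j ∈ T <;> simp only [ha, hb, if_true, if_false] at h2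
    · exact hTij (by simp [ha, hb])
    · exact absurd h2 (htb' i j ha hb)
    · exact absurd h2.symm (htb' j i hb ha)
    · exact hTij (by simp [ha, hb])

theorem mem_symmDiff_erase_neighborFinset {V : Type*} [Fintype V] (G : SimpleGraph V)
    (x y z : V) :
    z ∈ symmDiff ((G.neighborFinset x).erase y) ((G.neighborFinset y).erase x) ↔
      z ≠ x ∧ z ≠ y ∧ ¬ (G.Adj x z ↔ G.Adj y z) := by
  simp only [mem_symmDiff, mem_erase, SimpleGraph.mem_neighborFinset]
  by_cases hx : z = x
  · subst hx; simp
  by_cases hy : z = y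
  · subst hy; simp
  tauto

theorem nbhdDist_self {V : Type*} [Fintype V] (G : SimpleGraph V) (x : V) :
    nbhdDist G x x = 0 := by
  simp [nbhdDist]

theorem nbhdDist_comm {V : Type*} [Fintype V] (G : SimpleGraph V) (x y : V) :
    nbhdDist G x y = nbhdDist G y x := by
  rw [nbhdDist, nbhdDist, symmDiff_comm]

theorem nbhdDist_triangle {V : Type*} [Fintype V] (G : SimpleGraph V) (x y w : V) :
    nbhdDist G x w ≤ nbhdDist G x y + nbhdDist G y w := by
  by_cases hxy : x = y
  · subst hxy; simp
  by_cases hyw : y = w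
  · subst hyw; simp
  by_cases hxw : x = w
  · subst hxw; simp [nbhdDist_self]
  unfold nbhdDist
  set A := symmDiff ((G.neighborFinset x).erase w) ((G.neighborFinset w).erase x) with hA
  set B := symmDiff ((G.neighborFinset x).erase y) ((G.neighborFinset y).erase x) with hB
  set C := symmDiff ((G.neighborFinset y).erase w) ((G.neighborFinset w).erase y) with hC
  have mA := mem_symmDiff_erase_neighborFinset G x w
  have mB := mem_symmDiff_erase_neighborFinset G x y
  have mC := mem_symmDiff_erase_neighborFinset G y w
  rw [← hA] at mA
  rw [← hB] at mB
  rw [← hC] at mC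
  have hsub : A.erase y ⊆ B.erase w ∪ C.erase x := by
    intro z
    simp only [mem_union, mem_erase, mA, mB, mC]
    tauto
  have hc := (card_le_card hsub).trans (card_union_le _ _)
  by_cases hy : y ∈ A
  · have h1 : w ∈ B ∨ x ∈ C := by
      rw [mA] at hy
      rw [mB, mC]
      have e1 := G.adj_comm x y
      have e2 := G.adj_comm w y
      have e3 := G.adj_comm w x
      by_cases a1 : G.Adj x y <;> by_cases a2 : G.Adj w y <;> by_cases a3 : G.Adj w x <;>
        simp_all [eq_comm]
    have := card_erase_add_one hy
    rcases h1 with h1 | h1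
    · have := card_erase_add_one h1
      have := card_erase_le (s := C) (a := x)
      omega
    · have := card_erase_add_one h1
      have := card_erase_le (s := B) (a := w)
      omega
  · rw [erase_eq_of_notMem hy] at hc
    have := card_erase_le (s := C) (a := x)
    have := card_erase_le (s := B) (a := w)
    omega

theorem distinctDegrees_le_fNumber {V : Type*} [Fintype V] (G : SimpleGraph V) (s : Finset V) :
    distinctDegrees G s ≤ fNumber G := by
  refine le_csSup ⟨Fintype.card V, ?_⟩ ⟨s, rfl⟩
  rintro _ ⟨t, rfl⟩
  exact card_image_le.trans (card_le_univ t)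

/-- `k` vertices at large pairwise neighbourhood-distance can be given distinct degrees. -/
theorem le_fNumber_of_nbhdDist_lt {V : Type*} [Fintype V] (G : SimpleGraph V) {k : ℕ}
    (x : Fin k → V) (h : ∀ i j, i ≠ j → k ^ 2 * 2 ^ k + k < nbhdDist G (x i) (x j)) :
    k ≤ fNumber G := by
  set X : Finset V := univ.image x
  have hXk : X.card ≤ k := by simpa using card_image_le (s := univ) (f := x)
  obtain ⟨S, hS, hinj⟩ := exists_subset_injective_count Xᶜ (fun i z => G.Adj (x i) z)
    (fun i => (X.filter fun z => G.Adj (x i) z).card) (by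
      intro i j hij
      have hsub : symmDiff ((G.neighborFinset (x i)).erase (x j))
          ((G.neighborFinset (x j)).erase (x i)) ⊆
          (Xᶜ.filter fun z => ¬ (G.Adj (x i) z ↔ G.Adj (x j) z)) ∪ X := by
        intro z hz
        rw [mem_symmDiff_erase_neighborFinset] at hz
        by_cases hzX : z ∈ X
        · exact mem_union_right _ hzX
        · exact mem_union_left _ (mem_filter.2 ⟨mem_compl.2 hzX, hz.2.2⟩)
      have h1 := (card_le_card hsub).trans (card_union_le _ _)
      have h2 := h i j hij
      rw [nbhdDist] at h2
      omega)
  have hdisj : Disjoint X S := disjoint_left.2 fun z hz hzS => mem_compl.1 (hS hzS) hz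
  refine le_trans ?_ (distinctDegrees_le_fNumber G (X ∪ S))
  have hdeg : ∀ i, ((X ∪ S).filter fun z => G.Adj (x i) z).card =
      (X.filter fun z => G.Adj (x i) z).card + (S.filter fun z => G.Adj (x i) z).card := by
    intro i
    rw [filter_union, card_union_of_disjoint (disjoint_filter_filter hdisj)]
  calc k = (univ.image fun i => ((X ∪ S).filter fun z => G.Adj (x i) z).card).card := by
        rw [card_image_of_injective, card_fin]
        intro i j hij
        simp only [hdeg] at hij
        exact hinj hij
    _ ≤ distinctDegrees G (X ∪ S) := by
        refine card_le_card ?_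
        intro d hd
        obtain ⟨i, -, rfl⟩ := mem_image.1 hd
        exact mem_image.2 ⟨x i, mem_union_left _ (mem_image_of_mem x (mem_univ i)), rfl⟩

/-- In a graph without an independent set of size `k`, connected vertices are at distance less
than `2 * (k - 1)`. -/
theorem SimpleGraph.Reachable.dist_lt_of_no_independent {V : Type*} {H : SimpleGraph V} {k : ℕ}
    (hH : ¬ ∃ x : Fin k → V, ∀ i j, i ≠ j → x i ≠ x j ∧ ¬ H.Adj (x i) (x j))
    {a b : V} (hab : H.Reachable a b) : H.dist a b < 2 * (k - 1) := by
  by_contra! hlt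
  obtain ⟨p, hp⟩ := hab.exists_walk_length_eq_dist
  refine hH ⟨fun i => p.getVert (2 * i), fun i j hij => ?_⟩
  have key : ∀ i j : Fin k, i < j →
      p.getVert (2 * i) ≠ p.getVert (2 * j) ∧ ¬ H.Adj (p.getVert (2 * i)) (p.getVert (2 * j)) := by
    intro i j hij
    have hij' : (i : ℕ) < j := hij
    have hj := j.2
    have hshort : ∀ q : H.Walk (p.getVert (2 * i)) (p.getVert (2 * j)), 2 ≤ q.length := by
      intro q
      have h1 := SimpleGraph.dist_le (((p.take (2 * i)).append q).append (p.drop (2 * j)))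
      simp only [SimpleGraph.Walk.length_append, SimpleGraph.Walk.take_length,
        SimpleGraph.Walk.drop_length] at h1
      omega
    refine ⟨fun he => ?_, fun had => ?_⟩
    · have := hshort (SimpleGraph.Walk.nil.copy rfl he)
      simp at this
    · have := hshort had.toWalk
      simp at this
  rcases lt_or_gt_of_ne hij with h | h
  · exact key i j h
  · exact ⟨(key j i h).1.symm, fun had => (key j i h).2 had.symm⟩

theorem nbhdDist_le_length_mul {V : Type*} [Fintype V] (G H : SimpleGraph V) (J : ℝ)
    (hH : ∀ x y, H.Adj x y → (nbhdDist G x y : ℝ) ≤ J) {a b : V} (p : H.Walk a b) :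
    (nbhdDist G a b : ℝ) ≤ p.length * J := by
  induction p with
  | nil => simp [nbhdDist_self]
  | @cons u v w huv q ih =>
    have h1 : (nbhdDist G u w : ℝ) ≤ nbhdDist G u v + nbhdDist G v w := by
      exact_mod_cast nbhdDist_triangle G u v w
    have h2 := hH u v huv
    rw [SimpleGraph.Walk.length_cons]
    push_cast
    linarith

/-- If no `k` vertices are at pairwise neighbourhood-distance more than `J`, the vertices can be
partitioned, up to fewer than `k` parts of size at most `c`, into large parts of small diameter
that are far apart. -/
theorem exists_separated_parts {V : Type*} [Fintype V] (G : SimpleGraph V) {k : ℕ}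
    {J c : ℝ} (hc : 0 ≤ c) (hJ : 0 ≤ J)
    (hG : ¬ ∃ x : Fin k → V, ∀ i j, i ≠ j → J < nbhdDist G (x i) (x j)) :
    ∃ (m : ℕ) (A : Fin m → Finset V),
      (∀ i j, i ≠ j → Disjoint (A i) (A j)) ∧
      (Fintype.card V : ℝ) - (k - 1) * c ≤ ((Finset.univ.biUnion A).card : ℝ) ∧
      (∀ i, c < ((A i).card : ℝ)) ∧
      (∀ i, ∀ x ∈ A i, ∀ y ∈ A i, (nbhdDist G x y : ℝ) ≤ 2 * k * J) ∧
      (∀ i j, i ≠ j → ∀ x ∈ A i, ∀ y ∈ A j, J < (nbhdDist G x y : ℝ)) := by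
  let H : SimpleGraph V :=
    { Adj := fun x y => x ≠ y ∧ (nbhdDist G x y : ℝ) ≤ J
      symm := ⟨fun x y h => ⟨h.1.symm, by rw [nbhdDist_comm]; exact h.2⟩⟩
      loopless := ⟨fun x h => h.1 rfl⟩ }
  have hfar : ∀ x y, x ≠ y → ¬ H.Adj x y → J < nbhdDist G x y := by
    intro x y hxy hn
    by_contra! hle
    exact hn ⟨hxy, hle⟩
  have hH : ¬ ∃ x : Fin k → V, ∀ i j, i ≠ j → x i ≠ x j ∧ ¬ H.Adj (x i) (x j) :=
    fun ⟨x, hx⟩ => hG ⟨x, fun i j hij => hfar _ _ (hx i j hij).1 (hx i j hij).2⟩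
  have hsep : ∀ x y, H.connectedComponentMk x ≠ H.connectedComponentMk y →
      x ≠ y ∧ ¬ H.Adj x y := by
    intro x y hxy
    exact ⟨fun h => hxy (by rw [h]), fun h => hxy (SimpleGraph.ConnectedComponent.sound h.reachable)⟩
  have : Fintype H.ConnectedComponent := Fintype.ofFinite _
  have hcomp : Fintype.card H.ConnectedComponent < k := by
    by_contra! hle
    obtain ⟨g⟩ := Function.Embedding.nonempty_of_card_le
      (α := Fin k) (β := H.ConnectedComponent) (by simpa using hle)
    refine hH ⟨fun i => (g i).out, fun i j hij => hsep _ _ ?_⟩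
    have ho : ∀ C : H.ConnectedComponent, H.connectedComponentMk C.out = C := Quot.out_eq
    rw [ho, ho]
    exact g.injective.ne hij
  let B : H.ConnectedComponent → Finset V :=
    fun C => univ.filter fun x => H.connectedComponentMk x = C
  have hB : ∀ x C, x ∈ B C ↔ H.connectedComponentMk x = C := by simp [B]
  let L : Finset H.ConnectedComponent := univ.filter fun C => c < (B C).card
  let A : Fin L.card → Finset V := fun i => B (L.equivFin.symm i)
  have hne : ∀ i j, i ≠ j →
      (L.equivFin.symm i : H.ConnectedComponent) ≠ L.equivFin.symm j := fun i j hij h =>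
    hij (L.equivFin.symm.injective (Subtype.ext h))
  refine ⟨L.card, A, ?_, ?_, ?_, ?_, ?_⟩
  · intro i j hij
    refine disjoint_left.2 fun x hi hj => hne i j hij ?_
    rw [← (hB _ _).1 hi, (hB _ _).1 hj]
  · have hcover : (univ : Finset V) ⊆ univ.biUnion A ∪ (univ \ L).biUnion B := by
      intro x _
      by_cases hx : H.connectedComponentMk x ∈ L
      · refine mem_union_left _ (mem_biUnion.2 ⟨L.equivFin ⟨_, hx⟩, mem_univ _, ?_⟩)
        rw [hB]
        simp
      · exact mem_union_right _ (mem_biUnion.2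
          ⟨_, mem_sdiff.2 ⟨mem_univ _, hx⟩, (hB _ _).2 rfl⟩)
    have h1 := (card_le_card hcover).trans
      ((card_union_le _ _).trans (Nat.add_le_add_left card_biUnion_le _))
    have h2 : ((∑ C ∈ univ \ L, (B C).card : ℕ) : ℝ) ≤ (k - 1) * c := by
      push_cast
      calc ∑ C ∈ univ \ L, ((B C).card : ℝ) ≤ ∑ C ∈ univ \ L, c := by
            refine sum_le_sum fun C hC => ?_
            simpa [L] using hC
        _ = (univ \ L).card * c := by simp
        _ ≤ (k - 1) * c := by
            refine mul_le_mul_of_nonneg_right ?_ hc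
            have h3 : (univ \ L).card + 1 ≤ k := lt_of_le_of_lt (card_le_univ _) hcomp
            have h4 : (((univ \ L).card + 1 : ℕ) : ℝ) ≤ k := by exact_mod_cast h3
            push_cast at h4
            linarith
    have h3 : (Fintype.card V : ℝ) ≤
        (univ.biUnion A).card + ((∑ C ∈ univ \ L, (B C).card : ℕ) : ℝ) := by
      exact_mod_cast h1
    linarith
  · intro i
    exact (mem_filter.1 (L.equivFin.symm i).2).2
  · intro i x hx y hy
    have hr : H.Reachable x y := SimpleGraph.ConnectedComponent.exact
      (((hB _ _).1 hx).trans ((hB _ _).1 hy).symm)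
    obtain ⟨p, hp⟩ := hr.exists_walk_length_eq_dist
    have hd := hr.dist_lt_of_no_independent hH
    refine (nbhdDist_le_length_mul G H J (fun x y h => h.2) p).trans
      (mul_le_mul_of_nonneg_right ?_ hJ)
    have : p.length ≤ 2 * k := by omega
    exact_mod_cast this
  · intro i j hij x hx y hy
    have h := hsep x y (by
      rw [(hB _ _).1 hx, (hB _ _).1 hy]
      exact hne i j hij)
    exact hfar x y h.1 h.2

/-- The partition claim: for fixed `k ≥ 2` and `0 < ε < 1/2`, with
`β = ε/(10k)`, `η = εβ/(10⁵k²)`, `J = 10⁴·k¹²·2^{4k}/η⁴` and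
`K = 2·(10⁶k² + J·log(10⁴k)/log(1+β/2))`, every sufficiently large `n`-vertex graph `G` with
`hom(G) < n/(k-1+ε)` and `f(G) < k` admits pairwise disjoint vertex sets `A₁, …, A_m` covering
more than `(1-β)n` vertices, each of size more than `βn/(10⁴k)`, with all
neighbourhood-distances within a set less than `K` and all neighbourhood-distances between
different sets more than `J`. -/
theorem stmt_12 (k : ℕ) (hk : 2 ≤ k) (ε : ℝ) (hε₁ : 0 < ε) (hε₂ : ε < 1 / 2) :
    let β : ℝ := ε / (10 * k)
    let η : ℝ := ε * β / (10 ^ 5 * (k : ℝ) ^ 2)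
    let J : ℝ := 10 ^ 4 * (k : ℝ) ^ 12 * 2 ^ (4 * k) / η ^ 4
    let K : ℝ := 2 * (10 ^ 6 * (k : ℝ) ^ 2 +
      J * Real.log (10 ^ 4 * (k : ℝ)) / Real.log (1 + β / 2))
    ∃ N : ℕ, ∀ n : ℕ, N ≤ n → ∀ G : SimpleGraph (Fin n),
      (homNumber G : ℝ) < (n : ℝ) / ((k : ℝ) - 1 + ε) → fNumber G < k →
      ∃ (m : ℕ) (A : Fin m → Finset (Fin n)),
        (∀ i j, i ≠ j → Disjoint (A i) (A j)) ∧
        ((Finset.univ.biUnion A).card : ℝ) > (1 - β) * (n : ℝ) ∧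
        (∀ i, ((A i).card : ℝ) > β * (n : ℝ) / (10 ^ 4 * (k : ℝ))) ∧
        (∀ i, ∀ x ∈ A i, ∀ y ∈ A i, (nbhdDist G x y : ℝ) < K) ∧
        (∀ i j, i ≠ j → ∀ x ∈ A i, ∀ y ∈ A j, (nbhdDist G x y : ℝ) > J) := by
  intro β η J K
  have hk' : (2 : ℝ) ≤ k := by exact_mod_cast hk
  have hβ : 0 < β := by positivity
  have hη : 0 < η := by positivity
  have hβ1 : β < 1 := by
    refine (div_lt_one (by positivity)).2 ?_
    linarith
  have hη1 : η ≤ 1 := by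
    refine (div_le_one (by positivity)).2 ?_
    nlinarith
  have hJ : (k : ℝ) ^ 2 * 2 ^ k + k ≤ J := by
    have h1 : 10 ^ 4 * (k : ℝ) ^ 12 * 2 ^ (4 * k) ≤ J :=
      le_div_self (by positivity) (by positivity) (pow_le_one₀ hη.le hη1)
    have h2 : (k : ℝ) ^ 2 ≤ (k : ℝ) ^ 12 := pow_le_pow_right₀ (by linarith) (by norm_num)
    have h3 : (2 : ℝ) ^ k ≤ 2 ^ (4 * k) := pow_le_pow_right₀ (by norm_num) (by omega)
    have h4 : (k : ℝ) ^ 2 * 2 ^ k ≤ (k : ℝ) ^ 12 * 2 ^ (4 * k) := by gcongr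
    have h5 : (1 : ℝ) ≤ 2 ^ k := one_le_pow₀ (by norm_num)
    have h6 : (k : ℝ) ≤ (k : ℝ) ^ 2 * 2 ^ k := by nlinarith
    nlinarith
  have hJ0 : 0 < J := lt_of_lt_of_le (by positivity) hJ
  have hK : 2 * k * J < K := by
    have hl : 0 < Real.log (1 + β / 2) := Real.log_pos (by linarith)
    have hl' : Real.log (1 + β / 2) ≤ β / 2 := by
      have := Real.log_le_sub_one_of_pos (show 0 < 1 + β / 2 by linarith)
      linarith
    have hβk : β * k ≤ 1 := by
      have : β * k = ε / 10 := by
        simp only [β]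
        field_simp
      linarith
    have hlog : 1 ≤ Real.log (10 ^ 4 * (k : ℝ)) := by
      rw [Real.le_log_iff_exp_le (by positivity)]
      have := Real.exp_one_lt_d9
      linarith
    have h1 : J * k ≤ J * Real.log (10 ^ 4 * (k : ℝ)) / Real.log (1 + β / 2) := by
      rw [le_div_iff₀ hl, mul_assoc]
      refine mul_le_mul_of_nonneg_left ?_ hJ0.le
      calc k * Real.log (1 + β / 2) ≤ k * (β / 2) := by gcongr
        _ = β * k / 2 := by ring
        _ ≤ 1 := by linarith
        _ ≤ Real.log (10 ^ 4 * (k : ℝ)) := hlog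
    have h2 : (0 : ℝ) < 10 ^ 6 * (k : ℝ) ^ 2 := by positivity
    simp only [K]
    linarith
  refine ⟨1, fun n hn G _ hf => ?_⟩
  have hn' : (1 : ℝ) ≤ n := by exact_mod_cast hn
  obtain ⟨m, A, h1, h2, h3, h4, h5⟩ := exists_separated_parts G (k := k)
    (J := J) (c := β * n / (10 ^ 4 * k)) (by positivity) hJ0.le (by
      rintro ⟨x, hx⟩
      refine absurd (le_fNumber_of_nbhdDist_lt G x fun i j hij => ?_) (not_le.2 hf)
      exact_mod_cast hJ.trans_lt (hx i j hij))
  refine ⟨m, A, h1, ?_, h3, fun i x hx y hy => (h4 i x hx y hy).trans_lt hK, h5⟩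
  rw [Fintype.card_fin] at h2
  refine lt_of_lt_of_le ?_ (h2.trans_eq (by congr!))
  have : ((k : ℝ) - 1) * (β * n / (10 ^ 4 * k)) < β * n := by
    rw [mul_div_assoc', div_lt_iff₀ (by positivity)]
    have : 0 < β * n := by positivity
    nlinarith
  linarith
end
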